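/- arXiv:0901.0207 — 9 statements merged into one kernel-verified Lean document; each statement's English description precedes it below -/
import Mathlib

section
/- Suppose Π(A₃) = 0, Π(A₂) > 0 and θ₂ ≤ θ₄. Then L*(Π) = {u ∈ ℝ : θ₂ ≤ u and u ≤ θ₄} (the inequalities being taken in the extended reals). In particular L*(Π) is the interval with left endpoint θ₂ and right endpoint θ₄. (Measure-theoretic form of case (a) of Proposition 'endpoints of L star' (5): under condition (a) of the lower bound theorem, the set of starting values at which the GOU process has no negative jumps equals [θ₂, θ₄].) -/
open MeasureTheory Set Filter

noncomputable section

/-- The region below the curve `y = u (e^{-x} - 1)`: jumps causing a negative jump of the GOU. -/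
def Cneg (u : ℝ) : Set (ℝ × ℝ) := {p | p.2 - u * (Real.exp (-p.1) - 1) < 0}

/-- The region above the curve `y = u (e^{-x} - 1)`: jumps causing a positive jump of the GOU. -/
def Cpos (u : ℝ) : Set (ℝ × ℝ) := {p | 0 < p.2 - u * (Real.exp (-p.1) - 1)}

/-- Set of starting values at which the GOU process has no negative jumps. -/
def Lstar (mu : Measure (ℝ × ℝ)) : Set ℝ := {u | mu (Cneg u) = 0}

/-- Set of starting values at which the GOU process has no positive jumps. -/
def Ustar (mu : Measure (ℝ × ℝ)) : Set ℝ := {u | mu (Cpos u) = 0}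

def A1 : Set (ℝ × ℝ) := {p | 0 ≤ p.1 ∧ 0 ≤ p.2}
def A2 : Set (ℝ × ℝ) := {p | 0 ≤ p.1 ∧ p.2 ≤ 0}
def A3 : Set (ℝ × ℝ) := {p | p.1 ≤ 0 ∧ p.2 ≤ 0}
def A4 : Set (ℝ × ℝ) := {p | p.1 ≤ 0 ∧ 0 ≤ p.2}

noncomputable def theta1 (mu : Measure (ℝ × ℝ)) : EReal :=
  if 0 < mu (A1 \ A4) then
    sSup ((fun v : ℝ => (v : EReal)) '' {v | v ≤ 0 ∧ 0 < mu (A1 ∩ Cneg v)}) else ⊥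

noncomputable def theta2 (mu : Measure (ℝ × ℝ)) : EReal :=
  if 0 < mu (A2 \ A1) then
    sSup ((fun v : ℝ => (v : EReal)) '' {v | 0 ≤ v ∧ 0 < mu (A2 ∩ Cneg v)}) else 0

noncomputable def theta3 (mu : Measure (ℝ × ℝ)) : EReal :=
  if 0 < mu (A3 \ A4) then
    sInf ((fun v : ℝ => (v : EReal)) '' {v | v ≤ 0 ∧ 0 < mu (A3 ∩ Cneg v)}) else 0

noncomputable def theta4 (mu : Measure (ℝ × ℝ)) : EReal :=
  if 0 < mu (A4 \ A1) then
    sInf ((fun v : ℝ => (v : EReal)) '' {v | 0 ≤ v ∧ 0 < mu (A4 ∩ Cneg v)}) else ⊤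

noncomputable def theta1' (mu : Measure (ℝ × ℝ)) : EReal :=
  if 0 < mu (A1 \ A2) then
    sInf ((fun v : ℝ => (v : EReal)) '' {v | v ≤ 0 ∧ 0 < mu (A1 ∩ Cpos v)}) else 0

noncomputable def theta2' (mu : Measure (ℝ × ℝ)) : EReal :=
  if 0 < mu (A2 \ A3) then
    sInf ((fun v : ℝ => (v : EReal)) '' {v | 0 ≤ v ∧ 0 < mu (A2 ∩ Cpos v)}) else ⊤

noncomputable def theta3' (mu : Measure (ℝ × ℝ)) : EReal :=
  if 0 < mu (A3 \ A2) then
    sSup ((fun v : ℝ => (v : EReal)) '' {v | v ≤ 0 ∧ 0 < mu (A3 ∩ Cpos v)}) else ⊥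

noncomputable def theta4' (mu : Measure (ℝ × ℝ)) : EReal :=
  if 0 < mu (A4 \ A3) then
    sSup ((fun v : ℝ => (v : EReal)) '' {v | 0 ≤ v ∧ 0 < mu (A4 ∩ Cpos v)}) else 0

theorem mem_Cneg {u : ℝ} {p : ℝ × ℝ} :
    p ∈ Cneg u ↔ p.2 - u * (Real.exp (-p.1) - 1) < 0 := Iff.rfl

theorem exp_neg_sub_one_nonpos {x : ℝ} (hx : 0 ≤ x) : Real.exp (-x) - 1 ≤ 0 :=
  sub_nonpos.2 (Real.exp_le_one_iff.2 (neg_nonpos.2 hx))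

theorem exp_neg_sub_one_nonneg {x : ℝ} (hx : x ≤ 0) : 0 ≤ Real.exp (-x) - 1 :=
  sub_nonneg.2 (Real.one_le_exp (neg_nonneg.2 hx))

theorem A2_inter_Cneg_anti {u v : ℝ} (h : u ≤ v) : A2 ∩ Cneg v ⊆ A2 ∩ Cneg u := by
  rintro p ⟨hp, hv⟩
  have := mul_le_mul_of_nonpos_right h (exp_neg_sub_one_nonpos hp.1)
  exact ⟨hp, mem_Cneg.2 (by linarith [mem_Cneg.1 hv])⟩

theorem A4_inter_Cneg_mono {u v : ℝ} (h : u ≤ v) : A4 ∩ Cneg u ⊆ A4 ∩ Cneg v := by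
  rintro p ⟨hp, hu⟩
  have := mul_le_mul_of_nonneg_right h (exp_neg_sub_one_nonneg hp.1)
  exact ⟨hp, mem_Cneg.2 (by linarith [mem_Cneg.1 hu])⟩

theorem A1_inter_Cneg_eq_empty {u : ℝ} (hu : 0 ≤ u) : A1 ∩ Cneg u = ∅ := by
  refine eq_empty_of_forall_notMem fun p ⟨hp, hc⟩ ↦ ?_
  have := mul_nonpos_of_nonneg_of_nonpos hu (exp_neg_sub_one_nonpos hp.1)
  linarith [mem_Cneg.1 hc, hp.2]

theorem A4_inter_Cneg_zero : A4 ∩ Cneg 0 = ∅ := by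
  refine eq_empty_of_forall_notMem fun p ⟨hp, hc⟩ ↦ ?_
  linarith [mem_Cneg.1 hc, hp.2]

theorem inter_Cneg_subset_diff_A1 (S : Set (ℝ × ℝ)) {u : ℝ} (hu : 0 ≤ u) :
    S ∩ Cneg u ⊆ S \ A1 := fun _ ⟨hS, hc⟩ ↦
  ⟨hS, fun h1 ↦ (A1_inter_Cneg_eq_empty hu).subset ⟨h1, hc⟩⟩

theorem A2_diff_A3_subset_Cneg {u : ℝ} (hu : u < 0) : A2 \ A3 ⊆ Cneg u := by
  rintro p ⟨⟨_, hy⟩, hp⟩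
  have hx : 0 < p.1 := not_le.1 fun h ↦ hp ⟨h, hy⟩
  have hexp : Real.exp (-p.1) < 1 := Real.exp_lt_one_iff.2 (neg_neg_iff_pos.2 hx)
  have := mul_pos_of_neg_of_neg hu (sub_neg.2 hexp)
  exact mem_Cneg.2 (by linarith)

/-- `Cneg` is lower semicontinuous in `u`, so nullity passes to limits of the parameter. -/
theorem measure_inter_Cneg_eq_zero_of_tendsto {mu : Measure (ℝ × ℝ)} {S : Set (ℝ × ℝ)}
    {v : ℕ → ℝ} {u : ℝ} (hv : Tendsto v atTop (nhds u)) (h : ∀ n, mu (S ∩ Cneg (v n)) = 0) :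
    mu (S ∩ Cneg u) = 0 := by
  refine measure_mono_null ?_ (measure_iUnion_null h)
  rintro p ⟨hS, hp⟩
  have hlim : Tendsto (fun n ↦ p.2 - v n * (Real.exp (-p.1) - 1)) atTop
      (nhds (p.2 - u * (Real.exp (-p.1) - 1))) := (hv.mul_const _).const_sub _
  obtain ⟨n, hn⟩ := (hlim.eventually_lt_const (mem_Cneg.1 hp)).exists
  exact mem_iUnion.2 ⟨n, hS, hn⟩

theorem theta2_nonneg (mu : Measure (ℝ × ℝ)) : 0 ≤ theta2 mu := by
  unfold theta2
  split_ifs with h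
  · refine le_sSup ⟨0, ⟨le_rfl, h.trans_le (measure_mono ?_)⟩, rfl⟩
    rintro p ⟨hp, h1⟩
    have hy : p.2 < 0 := not_le.1 fun hy ↦ h1 ⟨hp.1, hy⟩
    exact ⟨hp, mem_Cneg.2 (by linarith)⟩
  · exact le_rfl

theorem theta2_le_iff (mu : Measure (ℝ × ℝ)) {u : ℝ} (hu : 0 ≤ u) :
    theta2 mu ≤ u ↔ mu (A2 ∩ Cneg u) = 0 := by
  unfold theta2
  split_ifs with h
  · simp only [sSup_le_iff, forall_mem_image, mem_ofPred_eq, EReal.coe_le_coe_iff]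
    constructor
    · intro H
      obtain ⟨v, -, hv, hlim⟩ := exists_seq_strictAnti_tendsto u
      refine measure_inter_Cneg_eq_zero_of_tendsto hlim fun n ↦ ?_
      by_contra hn
      exact (hv n).not_ge (H ⟨hu.trans (hv n).le, pos_iff_ne_zero.2 hn⟩)
    · rintro h0 v ⟨-, hv⟩
      by_contra! huv
      exact hv.ne' (measure_mono_null (A2_inter_Cneg_anti huv.le) h0)
  · exact iff_of_true (by exact_mod_cast hu)
      (measure_mono_null (inter_Cneg_subset_diff_A1 A2 hu) (by simpa using h))

theorem le_theta4_iff (mu : Measure (ℝ × ℝ)) {u : ℝ} (hu : 0 ≤ u) :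
    u ≤ theta4 mu ↔ mu (A4 ∩ Cneg u) = 0 := by
  unfold theta4
  split_ifs with h
  · simp only [le_sInf_iff, forall_mem_image, mem_ofPred_eq, EReal.coe_le_coe_iff]
    constructor
    · intro H
      obtain rfl | hu := hu.eq_or_lt
      · simp [A4_inter_Cneg_zero]
      obtain ⟨v, -, hv, hlim⟩ := exists_seq_strictMono_tendsto' hu
      refine measure_inter_Cneg_eq_zero_of_tendsto hlim fun n ↦ ?_
      by_contra hn
      exact (hv n).2.not_ge (H ⟨(hv n).1.le, pos_iff_ne_zero.2 hn⟩)
    · rintro h0 v ⟨-, hv⟩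
      by_contra! huv
      exact hv.ne' (measure_mono_null (A4_inter_Cneg_mono huv.le) h0)
  · exact iff_of_true le_top
      (measure_mono_null (inter_Cneg_subset_diff_A1 A4 hu) (by simpa using h))

theorem measure_Cneg_eq_zero_iff {mu : Measure (ℝ × ℝ)} (h3 : mu A3 = 0) {u : ℝ} (hu : 0 ≤ u) :
    mu (Cneg u) = 0 ↔ mu (A2 ∩ Cneg u) = 0 ∧ mu (A4 ∩ Cneg u) = 0 := by
  refine ⟨fun h ↦ ⟨measure_mono_null inter_subset_right h, measure_mono_null inter_subset_right h⟩,
    fun ⟨h2, h4⟩ ↦ measure_mono_null ?_ (measure_union_null (measure_union_null h2 h4) h3)⟩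
  intro p hp
  have h1 : p ∉ A1 := fun h1 ↦ (A1_inter_Cneg_eq_empty hu).subset ⟨h1, hp⟩
  rcases le_total 0 p.1 with hx | hx <;> rcases le_total 0 p.2 with hy | hy
  · exact absurd ⟨hx, hy⟩ h1
  · exact .inl (.inl ⟨⟨hx, hy⟩, hp⟩)
  · exact .inl (.inr ⟨⟨hx, hy⟩, hp⟩)
  · exact .inr ⟨hx, hy⟩

theorem lstar_eq_interval_case_a (mu : Measure (ℝ × ℝ))
    (h3 : mu A3 = 0) (h2 : 0 < mu A2) (hth : theta2 mu ≤ theta4 mu) :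
    Lstar mu = {u : ℝ | theta2 mu ≤ (u : EReal) ∧ (u : EReal) ≤ theta4 mu} := by
  ext u
  change mu (Cneg u) = 0 ↔ theta2 mu ≤ u ∧ u ≤ theta4 mu
  rcases le_or_gt 0 u with hu | hu
  · rw [measure_Cneg_eq_zero_iff h3 hu, theta2_le_iff mu hu, le_theta4_iff mu hu]
  · refine iff_of_false (fun h ↦ h2.ne' ?_) fun h ↦ ?_
    · rw [← measure_sdiff_null h3]
      exact measure_mono_null (A2_diff_A3_subset_Cneg hu) h
    · exact hu.not_ge (by exact_mod_cast (theta2_nonneg mu).trans h.1)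

end
end

section
/- Suppose Π(A₁) = 0, Π(A₄) > 0 and θ₄' ≤ θ₂'. Then U*(Π) = {u ∈ ℝ : θ₄' ≤ u and u ≤ θ₂'} (the inequalities being taken in the extended reals). (Measure-theoretic form of case (a) of condition (ii) of the upper bound theorem: the set of starting values at which the GOU process has no positive jumps equals [θ₄', θ₂'].) -/
open MeasureTheory Set Filter

noncomputable section

theorem measure_inter_Cpos_eq_zero_of_tendsto {mu : Measure (ℝ × ℝ)} {A : Set (ℝ × ℝ)}
    {u : ℝ} {v : ℕ → ℝ} (hv : Tendsto v atTop (nhds u))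
    (h : ∀ n, mu (A ∩ Cpos (v n)) = 0) : mu (A ∩ Cpos u) = 0 := by
  refine measure_mono_null ?_ (measure_iUnion_null h)
  rintro p ⟨hA, hp⟩
  have ht : Tendsto (fun n => p.2 - v n * (Real.exp (-p.1) - 1)) atTop
      (nhds (p.2 - u * (Real.exp (-p.1) - 1))) :=
    tendsto_const_nhds.sub (hv.mul_const _)
  obtain ⟨n, hn⟩ := (ht.eventually (lt_mem_nhds hp)).exists
  exact mem_iUnion.2 ⟨n, hA, hn⟩

theorem A4_inter_Cpos_anti {u v : ℝ} (huv : u ≤ v) : A4 ∩ Cpos v ⊆ A4 ∩ Cpos u := by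
  rintro p ⟨hA, hp⟩
  have := mul_le_mul_of_nonneg_right huv (exp_neg_sub_one_nonneg hA.1)
  refine ⟨hA, ?_⟩
  simp only [Cpos, mem_ofPred_eq] at hp ⊢
  linarith

theorem A2_inter_Cpos_mono {u v : ℝ} (huv : u ≤ v) : A2 ∩ Cpos u ⊆ A2 ∩ Cpos v := by
  rintro p ⟨hA, hp⟩
  have := mul_le_mul_of_nonpos_right huv (exp_neg_sub_one_nonpos hA.1)
  refine ⟨hA, ?_⟩
  simp only [Cpos, mem_ofPred_eq] at hp ⊢
  linarith

theorem A4_inter_Cpos_zero : A4 ∩ Cpos 0 = A4 \ A3 := by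
  ext p
  simp only [A4, A3, Cpos, mem_inter_iff, Set.mem_sdiff, mem_ofPred_eq, zero_mul, sub_zero, not_and,
    not_le]
  exact and_congr_right fun h => ⟨fun hp _ => hp, fun hp => hp h.1⟩

theorem A2_inter_Cpos_zero : A2 ∩ Cpos 0 = ∅ := by
  ext p
  simp only [A2, Cpos, mem_inter_iff, mem_ofPred_eq, zero_mul, sub_zero, mem_empty_iff_false,
    iff_false]
  rintro ⟨h, hp⟩
  linarith [h.2]

theorem A2_inter_Cpos_subset (u : ℝ) : A2 ∩ Cpos u ⊆ A2 \ A3 := by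
  rintro p ⟨hA, hp⟩
  refine ⟨hA, fun h3 => ?_⟩
  have hx : p.1 = 0 := le_antisymm h3.1 hA.1
  simp only [Cpos, mem_ofPred_eq, hx, neg_zero, Real.exp_zero, sub_self, mul_zero, sub_zero] at hp
  linarith [hA.2]

theorem theta4'_nonneg (mu : Measure (ℝ × ℝ)) : 0 ≤ theta4' mu := by
  unfold theta4'
  split_ifs with h
  · exact le_sSup ⟨0, ⟨le_rfl, by rwa [A4_inter_Cpos_zero]⟩, rfl⟩
  · exact le_rfl

theorem measure_A4_inter_Cpos_eq_zero_iff (mu : Measure (ℝ × ℝ)) {u : ℝ} (hu : 0 ≤ u) :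
    mu (A4 ∩ Cpos u) = 0 ↔ theta4' mu ≤ u := by
  unfold theta4'
  split_ifs with h
  · constructor
    · intro h0
      refine sSup_le ?_
      rintro _ ⟨v, ⟨-, hv⟩, rfl⟩
      refine EReal.coe_le_coe_iff.2 (le_of_not_gt fun huv => hv.ne' ?_)
      exact measure_mono_null (A4_inter_Cpos_anti huv.le) h0
    · intro hle
      obtain ⟨v, -, hv, ht⟩ := exists_seq_strictAnti_tendsto u
      refine measure_inter_Cpos_eq_zero_of_tendsto ht fun n => ?_
      by_contra hne
      have := sSup_le_iff.1 hle (v n) ⟨v n, ⟨hu.trans (hv n).le, pos_iff_ne_zero.2 hne⟩, rfl⟩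
      exact (hv n).not_ge (EReal.coe_le_coe_iff.1 this)
  · refine iff_of_true (measure_mono_null (A4_inter_Cpos_anti hu) ?_) (EReal.coe_nonneg.2 hu)
    rw [A4_inter_Cpos_zero]
    exact nonpos_iff_eq_zero.1 (not_lt.1 h)

theorem measure_A2_inter_Cpos_eq_zero_iff (mu : Measure (ℝ × ℝ)) {u : ℝ} (hu : 0 ≤ u) :
    mu (A2 ∩ Cpos u) = 0 ↔ (u : EReal) ≤ theta2' mu := by
  unfold theta2'
  split_ifs with h
  · constructor
    · intro h0
      refine le_sInf ?_
      rintro _ ⟨v, ⟨-, hv⟩, rfl⟩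
      refine EReal.coe_le_coe_iff.2 (le_of_not_gt fun huv => hv.ne' ?_)
      exact measure_mono_null (A2_inter_Cpos_mono huv.le) h0
    · intro hle
      rcases hu.eq_or_lt with rfl | hpos
      · rw [A2_inter_Cpos_zero, measure_empty]
      obtain ⟨v, -, hv, ht⟩ := exists_seq_strictMono_tendsto' hpos
      refine measure_inter_Cpos_eq_zero_of_tendsto ht fun n => ?_
      by_contra hne
      have := le_sInf_iff.1 hle (v n) ⟨v n, ⟨(hv n).1.le, pos_iff_ne_zero.2 hne⟩, rfl⟩
      exact (hv n).2.not_ge (EReal.coe_le_coe_iff.1 this)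
  · exact iff_of_true (measure_mono_null (A2_inter_Cpos_subset u)
      (nonpos_iff_eq_zero.1 (not_lt.1 h))) le_top

theorem Cpos_subset_of_nonneg {u : ℝ} (hu : 0 ≤ u) :
    Cpos u ⊆ A1 ∪ (A2 ∩ Cpos u ∪ A4 ∩ Cpos u) := by
  intro p hp
  rcases le_total 0 p.1 with hx | hx <;> rcases le_total 0 p.2 with hy | hy
  · exact Or.inl ⟨hx, hy⟩
  · exact Or.inr (Or.inl ⟨⟨hx, hy⟩, hp⟩)
  · exact Or.inr (Or.inr ⟨⟨hx, hy⟩, hp⟩)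
  · have := mul_nonneg hu (exp_neg_sub_one_nonneg hx)
    simp only [Cpos, mem_ofPred_eq] at hp
    linarith

theorem A4_subset_of_neg {u : ℝ} (hu : u < 0) : A4 ⊆ A1 ∪ Cpos u := by
  intro p hp
  rcases hp.1.eq_or_lt with hx | hx
  · exact Or.inl ⟨hx.ge, hp.2⟩
  · have h1 := Real.one_lt_exp_iff.2 (neg_pos.2 hx)
    have := mul_neg_of_neg_of_pos hu (sub_pos.2 h1)
    refine Or.inr ?_
    simp only [Cpos, mem_ofPred_eq]
    linarith [hp.2]

theorem measure_Cpos_eq_zero_iff {mu : Measure (ℝ × ℝ)} (h1 : mu A1 = 0) {u : ℝ} (hu : 0 ≤ u) :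
    mu (Cpos u) = 0 ↔ mu (A4 ∩ Cpos u) = 0 ∧ mu (A2 ∩ Cpos u) = 0 :=
  ⟨fun h => ⟨measure_mono_null inter_subset_right h, measure_mono_null inter_subset_right h⟩,
    fun h => measure_mono_null (Cpos_subset_of_nonneg hu)
      (measure_union_null h1 (measure_union_null h.2 h.1))⟩

theorem ustar_eq_interval_case_a (mu : Measure (ℝ × ℝ))
    (h1 : mu A1 = 0) (h4 : 0 < mu A4) (hth : theta4' mu ≤ theta2' mu) :
    Ustar mu = {u : ℝ | theta4' mu ≤ (u : EReal) ∧ (u : EReal) ≤ theta2' mu} := by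
  ext u
  simp only [Ustar, mem_ofPred_eq]
  rcases lt_or_ge u 0 with hu | hu
  · refine iff_of_false (fun h => h4.ne' ?_) fun h => ?_
    · exact measure_mono_null (A4_subset_of_neg hu) (measure_union_null h1 h)
    · exact hu.not_ge (EReal.coe_nonneg.1 ((theta4'_nonneg mu).trans h.1))
  · rw [measure_Cpos_eq_zero_iff h1 hu, measure_A4_inter_Cpos_eq_zero_iff mu hu,
      measure_A2_inter_Cpos_eq_zero_iff mu hu]

end
end

section
/- If L*(Π) = ℝ, then either U*(Π) = ∅ or U*(Π) = ℝ. (Statement (1) of the proposition on the possible combinations of L* and U*.) -/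
open MeasureTheory Set Filter

noncomputable section

theorem exists_int_mem_Cneg {p : ℝ × ℝ} (hp : p.1 ≠ 0) : ∃ n : ℤ, p ∈ Cneg n := by
  have hc : Real.exp (-p.1) - 1 ≠ 0 := by
    simpa [sub_eq_zero, Real.exp_eq_one_iff] using hp
  simp only [Cneg, mem_ofPred_eq, sub_neg]
  rcases hc.lt_or_gt with hc | hc
  · obtain ⟨n, hn⟩ := exists_int_lt (p.2 / (Real.exp (-p.1) - 1))
    exact ⟨n, (lt_div_iff_of_neg hc).1 hn⟩
  · obtain ⟨n, hn⟩ := exists_int_gt (p.2 / (Real.exp (-p.1) - 1))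
    exact ⟨n, (div_lt_iff₀ hc).1 hn⟩

theorem Cpos_subset_union (u v : ℝ) : Cpos v ⊆ Cpos u ∪ ⋃ n : ℤ, Cneg n := by
  intro p hp
  by_cases h : p.1 = 0
  · left
    simpa [Cpos, h] using hp
  · exact .inr (mem_iUnion.2 (exists_int_mem_Cneg h))

theorem ustar_of_lstar_univ (mu : Measure (ℝ × ℝ))
    (hL : Lstar mu = Set.univ) :
    Ustar mu = ∅ ∨ Ustar mu = Set.univ := by
  rw [or_iff_not_imp_left, ← Ne, ← nonempty_iff_ne_empty]
  rintro ⟨u, hu⟩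
  refine eq_univ_of_forall fun v => measure_mono_null (Cpos_subset_union u v) ?_
  refine measure_union_null hu (measure_iUnion_null fun n => ?_)
  exact (eq_univ_iff_forall.1 hL) n

end
end

section
/- If L*(Π) = [a, b] (the closed bounded interval) for some real numbers a ≤ b, then either U*(Π) = ∅, or a = b and U*(Π) = L*(Π) = {a}. (Statement (2) of the proposition on the possible combinations of L* and U*.) -/
open MeasureTheory Set Filter

noncomputable section

theorem mem_Lstar_iff {mu : Measure (ℝ × ℝ)} {u : ℝ} :
    u ∈ Lstar mu ↔ ∀ᵐ p ∂mu, u * (Real.exp (-p.1) - 1) ≤ p.2 := by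
  simp [Lstar, Cneg, ae_iff]

theorem mem_Ustar_iff {mu : Measure (ℝ × ℝ)} {u : ℝ} :
    u ∈ Ustar mu ↔ ∀ᵐ p ∂mu, p.2 ≤ u * (Real.exp (-p.1) - 1) := by
  simp [Ustar, Cpos, ae_iff]

/-- If some starting value below `w ∈ Ustar mu` lies in `Lstar mu`, then `Lstar mu` contains every
smaller starting value. -/
theorem mem_Lstar_of_le_of_lt_mem_Ustar {mu : Measure (ℝ × ℝ)} {u v w : ℝ}
    (hv : v ∈ Lstar mu) (hw : w ∈ Ustar mu) (hvw : v < w) (huv : u ≤ v) : u ∈ Lstar mu := by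
  rw [mem_Lstar_iff] at hv ⊢
  filter_upwards [hv, mem_Ustar_iff.1 hw] with p hvp hwp
  have hs : 0 ≤ Real.exp (-p.1) - 1 :=
    nonneg_of_mul_nonneg_right (by linarith : 0 ≤ (w - v) * _) (sub_pos.2 hvw)
  exact (mul_le_mul_of_nonneg_right huv hs).trans hvp

/-- If some starting value above `w ∈ Ustar mu` lies in `Lstar mu`, then `Lstar mu` contains every
larger starting value. -/
theorem mem_Lstar_of_ge_of_mem_Ustar_lt {mu : Measure (ℝ × ℝ)} {u v w : ℝ}
    (hv : v ∈ Lstar mu) (hw : w ∈ Ustar mu) (hwv : w < v) (hvu : v ≤ u) : u ∈ Lstar mu := by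
  rw [mem_Lstar_iff] at hv ⊢
  filter_upwards [hv, mem_Ustar_iff.1 hw] with p hvp hwp
  have hs : Real.exp (-p.1) - 1 ≤ 0 := by
    by_contra! h
    nlinarith [mul_pos (sub_pos.2 hwv) h]
  exact (mul_le_mul_of_nonpos_right hvu hs).trans hvp

/-- If `Lstar mu` is a compact interval, then no point of `Ustar mu` differs from a point of
`Lstar mu`. -/
theorem eq_of_mem_Lstar_of_mem_Ustar {mu : Measure (ℝ × ℝ)} {a b v w : ℝ}
    (hL : Lstar mu = Set.Icc a b) (hv : v ∈ Lstar mu) (hw : w ∈ Ustar mu) : v = w := by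
  have hvI : v ∈ Set.Icc a b := hL ▸ hv
  rcases lt_trichotomy v w with h | h | h
  · have := mem_Lstar_of_le_of_lt_mem_Ustar hv hw h (by linarith [hvI.1] : a - 1 ≤ v)
    rw [hL] at this
    linarith [this.1]
  · exact h
  · have := mem_Lstar_of_ge_of_mem_Ustar_lt hv hw h (by linarith [hvI.2] : v ≤ b + 1)
    rw [hL] at this
    linarith [this.2]

theorem ustar_of_lstar_Icc (mu : Measure (ℝ × ℝ)) (a b : ℝ) (hab : a ≤ b)
    (hL : Lstar mu = Set.Icc a b) :
    Ustar mu = ∅ ∨ (a = b ∧ Ustar mu = Lstar mu ∧ Lstar mu = {a}) := by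
  rcases (Ustar mu).eq_empty_or_nonempty with hU | ⟨w, hw⟩
  · exact Or.inl hU
  have ha : a ∈ Lstar mu := hL ▸ Set.left_mem_Icc.2 hab
  have hb : b ∈ Lstar mu := hL ▸ Set.right_mem_Icc.2 hab
  have haw : a = w := eq_of_mem_Lstar_of_mem_Ustar hL ha hw
  have hbw : b = w := eq_of_mem_Lstar_of_mem_Ustar hL hb hw
  have hab' : a = b := haw.trans hbw.symm
  have hLa : Lstar mu = {a} := by rw [hL, ← hab', Set.Icc_self]
  have hUa : Ustar mu = {a} :=
    Set.eq_singleton_iff_unique_mem.2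
      ⟨haw ▸ hw, fun z hz => (eq_of_mem_Lstar_of_mem_Ustar hL ha hz).symm⟩
  exact Or.inr ⟨hab', hUa.trans hLa.symm, hLa⟩

end
end

section
/- Assume Π({(0,0)}) = 0. Then the following inequalities hold in the extended reals: (1) if Π(A₁) > 0 then θ₁' ≤ θ₁ ≤ 0; (2) if Π(A₂) > 0 then 0 ≤ θ₂' ≤ θ₂; (3) if Π(A₃) > 0 then θ₃ ≤ θ₃' ≤ 0; (4) if Π(A₄) > 0 then 0 ≤ θ₄ ≤ θ₄'. (Statements (1)–(4) of the lemma on inequalities between the θᵢ and θᵢ'.) -/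
open MeasureTheory Set Filter

noncomputable section

lemma le_ite_sSup_coe {c : Prop} [Decidable c] {S : Set ℝ} {d : EReal} {v : ℝ}
    (hv : v ∈ S) (hc : c) :
    (v : EReal) ≤ if c then sSup ((fun v : ℝ => (v : EReal)) '' S) else d := by
  rw [if_pos hc]
  exact le_sSup (mem_image_of_mem _ hv)

lemma ite_sInf_coe_le {c : Prop} [Decidable c] {S : Set ℝ} {d : EReal} {v : ℝ}
    (hv : v ∈ S) (hc : c) :
    (if c then sInf ((fun v : ℝ => (v : EReal)) '' S) else d) ≤ v := by
  rw [if_pos hc]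
  exact sInf_le (mem_image_of_mem _ hv)

lemma ite_sSup_coe_nonpos {c : Prop} [Decidable c] {S : Set ℝ} (hS : ∀ v ∈ S, v ≤ 0) :
    (if c then sSup ((fun v : ℝ => (v : EReal)) '' S) else ⊥) ≤ 0 := by
  split_ifs
  · refine sSup_le ?_
    rintro _ ⟨v, hv, rfl⟩
    exact EReal.coe_nonpos.2 (hS v hv)
  · exact bot_le

lemma ite_sInf_coe_nonneg {c : Prop} [Decidable c] {S : Set ℝ} (hS : ∀ v ∈ S, 0 ≤ v) :
    0 ≤ if c then sInf ((fun v : ℝ => (v : EReal)) '' S) else ⊤ := by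
  split_ifs
  · refine le_sInf ?_
    rintro _ ⟨v, hv, rfl⟩
    exact EReal.coe_nonneg.2 (hS v hv)
  · exact le_top

lemma ite_sSup_coe_zero_nonneg {c : Prop} [Decidable c] {S : Set ℝ} (hS : c → (0 : ℝ) ∈ S) :
    0 ≤ if c then sSup ((fun v : ℝ => (v : EReal)) '' S) else 0 := by
  split_ifs with hc
  · exact le_sSup ⟨0, hS hc, rfl⟩
  · exact le_rfl

lemma ite_sInf_coe_zero_nonpos {c : Prop} [Decidable c] {S : Set ℝ} (hS : c → (0 : ℝ) ∈ S) :
    (if c then sInf ((fun v : ℝ => (v : EReal)) '' S) else 0) ≤ 0 := by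
  split_ifs with hc
  · exact sInf_le ⟨0, hS hc, rfl⟩
  · exact le_rfl

/-- Two distinct curves `y = v (e^{-x} - 1)` meet only at the origin. -/
lemma eq_zero_of_notMem_Cneg_Cpos {v w : ℝ} (hvw : v ≠ w) {p : ℝ × ℝ}
    (hv : p ∉ Cneg v) (hv' : p ∉ Cpos v) (hw : p ∉ Cneg w) (hw' : p ∉ Cpos w) :
    p = (0, 0) := by
  simp only [Cneg, Cpos, mem_ofPred_eq, not_lt] at hv hv' hw hw'
  have h1 : p.2 = v * (Real.exp (-p.1) - 1) := by linarith
  have h2 : p.2 = w * (Real.exp (-p.1) - 1) := by linarith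
  have h3 : (v - w) * (Real.exp (-p.1) - 1) = 0 := by linarith
  have h4 : Real.exp (-p.1) - 1 = 0 := (mul_eq_zero.1 h3).resolve_left (sub_ne_zero.2 hvw)
  have h5 : -p.1 = 0 := Real.exp_eq_one_iff _ |>.1 (by linarith)
  refine Prod.ext ?_ ?_
  · simpa using h5
  · simp [h1, h4]

/-- A set of positive measure cannot be concentrated on each of the curves with parameter in a
nonempty open interval. -/
lemma le_of_forall_concentrated {mu : Measure (ℝ × ℝ)} (h0 : mu {((0 : ℝ), (0 : ℝ))} = 0)
    {A : Set (ℝ × ℝ)} (hA : 0 < mu A) {a b : EReal}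
    (h : ∀ v : ℝ, a < v → (v : EReal) < b →
      ¬ 0 < mu (A ∩ Cneg v) ∧ ¬ 0 < mu (A ∩ Cpos v)) : b ≤ a := by
  by_contra! hab
  obtain ⟨w, haw, hwb⟩ := EReal.lt_iff_exists_real_btwn.1 hab
  obtain ⟨v, hav, hvw⟩ := EReal.lt_iff_exists_real_btwn.1 haw
  have hne : v ≠ w := by
    rintro rfl
    exact lt_irrefl _ hvw
  obtain ⟨h1, h2⟩ := h v hav (hvw.trans hwb)
  obtain ⟨h3, h4⟩ := h w haw hwb
  simp only [not_lt, nonpos_iff_eq_zero] at h1 h2 h3 h4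
  refine hA.ne' (measure_mono_null (t := (A ∩ Cneg v ∪ A ∩ Cpos v) ∪ (A ∩ Cneg w ∪ A ∩ Cpos w) ∪
    {((0 : ℝ), (0 : ℝ))}) (fun p hp => ?_) ?_)
  · by_contra hn
    simp only [mem_union, mem_inter_iff, hp, true_and, not_or, mem_singleton_iff] at hn
    exact hn.2 (eq_zero_of_notMem_Cneg_Cpos hne hn.1.1.1 hn.1.1.2 hn.1.2.1 hn.1.2.2)
  · simp only [measure_union_null_iff, h0, h1, h2, h3, h4, and_self]

theorem theta_inequalities (mu : Measure (ℝ × ℝ))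
    (h0 : mu {((0 : ℝ), (0 : ℝ))} = 0) :
    (0 < mu A1 → theta1' mu ≤ theta1 mu ∧ theta1 mu ≤ 0) ∧
    (0 < mu A2 → 0 ≤ theta2' mu ∧ theta2' mu ≤ theta2 mu) ∧
    (0 < mu A3 → theta3 mu ≤ theta3' mu ∧ theta3' mu ≤ 0) ∧
    (0 < mu A4 → 0 ≤ theta4 mu ∧ theta4 mu ≤ theta4' mu) := by
  have mono {A B : Set (ℝ × ℝ)} (h : A ⊆ B) (hA : 0 < mu A) : 0 < mu B :=
    hA.trans_le (measure_mono h)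
  have exp_le {x : ℝ} (hx : 0 ≤ x) : Real.exp (-x) - 1 ≤ 0 := by
    simpa using hx
  have le_exp {x : ℝ} (hx : x ≤ 0) : 0 ≤ Real.exp (-x) - 1 := by
    simpa using hx
  refine ⟨fun hA => ⟨?_, ?_⟩, fun hA => ⟨?_, ?_⟩, fun hA => ⟨?_, ?_⟩, fun hA => ⟨?_, ?_⟩⟩
  · have hzero : theta1' mu ≤ 0 := by
      refine ite_sInf_coe_zero_nonpos fun hc => ⟨le_rfl, mono ?_ hc⟩
      rintro ⟨x, y⟩ ⟨hp, hq⟩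
      simp only [A1, A2, Cpos, mem_inter_iff, mem_ofPred_eq] at hp hq ⊢
      grind
    refine le_of_forall_concentrated h0 hA fun v hv hv' => ?_
    have hv0 : v ≤ 0 := by
      exact_mod_cast (hv'.trans_le hzero).le
    refine ⟨fun hN => hv.not_ge (le_ite_sSup_coe ⟨hv0, hN⟩ (mono ?_ hN)),
      fun hP => hv'.not_ge (ite_sInf_coe_le ⟨hv0, hP⟩ (mono ?_ hP))⟩
    all_goals
      rintro ⟨x, y⟩ ⟨hp, hq⟩
      simp only [A1, A4, A2, Cneg, Cpos, Set.mem_sdiff, mem_ofPred_eq] at hp hq ⊢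
      have := mul_nonneg_of_nonpos_of_nonpos hv0 (exp_le hp.1)
      grind
  · exact ite_sSup_coe_nonpos fun v hv => hv.1
  · exact ite_sInf_coe_nonneg fun v hv => hv.1
  · have hzero : 0 ≤ theta2 mu := by
      refine ite_sSup_coe_zero_nonneg fun hc => ⟨le_rfl, mono ?_ hc⟩
      rintro ⟨x, y⟩ ⟨hp, hq⟩
      simp only [A2, A1, Cneg, mem_inter_iff, mem_ofPred_eq] at hp hq ⊢
      grind
    refine le_of_forall_concentrated h0 hA fun v hv hv' => ?_
    have hv0 : 0 ≤ v := by
      exact_mod_cast (hzero.trans_lt hv).le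
    refine ⟨fun hN => hv.not_ge (le_ite_sSup_coe ⟨hv0, hN⟩ (mono ?_ hN)),
      fun hP => hv'.not_ge (ite_sInf_coe_le ⟨hv0, hP⟩ (mono ?_ hP))⟩
    all_goals
      rintro ⟨x, y⟩ ⟨hp, hq⟩
      simp only [A2, A1, A3, Cneg, Cpos, Set.mem_sdiff, mem_ofPred_eq] at hp hq ⊢
      have := mul_nonpos_of_nonneg_of_nonpos hv0 (exp_le hp.1)
      grind
  · have hzero : theta3 mu ≤ 0 := by
      refine ite_sInf_coe_zero_nonpos fun hc => ⟨le_rfl, mono ?_ hc⟩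
      rintro ⟨x, y⟩ ⟨hp, hq⟩
      simp only [A3, A4, Cneg, mem_inter_iff, mem_ofPred_eq] at hp hq ⊢
      grind
    refine le_of_forall_concentrated h0 hA fun v hv hv' => ?_
    have hv0 : v ≤ 0 := by
      exact_mod_cast (hv'.trans_le hzero).le
    refine ⟨fun hN => hv'.not_ge (ite_sInf_coe_le ⟨hv0, hN⟩ (mono ?_ hN)),
      fun hP => hv.not_ge (le_ite_sSup_coe ⟨hv0, hP⟩ (mono ?_ hP))⟩
    all_goals
      rintro ⟨x, y⟩ ⟨hp, hq⟩
      simp only [A3, A4, A2, Cneg, Cpos, Set.mem_sdiff, mem_ofPred_eq] at hp hq ⊢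
      have := mul_nonpos_of_nonpos_of_nonneg hv0 (le_exp hp.1)
      grind
  · exact ite_sSup_coe_nonpos fun v hv => hv.1
  · exact ite_sInf_coe_nonneg fun v hv => hv.1
  · have hzero : 0 ≤ theta4' mu := by
      refine ite_sSup_coe_zero_nonneg fun hc => ⟨le_rfl, mono ?_ hc⟩
      rintro ⟨x, y⟩ ⟨hp, hq⟩
      simp only [A4, A3, Cpos, mem_inter_iff, mem_ofPred_eq] at hp hq ⊢
      grind
    refine le_of_forall_concentrated h0 hA fun v hv hv' => ?_
    have hv0 : 0 ≤ v := by
      exact_mod_cast (hzero.trans_lt hv).le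
    refine ⟨fun hN => hv'.not_ge (ite_sInf_coe_le ⟨hv0, hN⟩ (mono ?_ hN)),
      fun hP => hv.not_ge (le_ite_sSup_coe ⟨hv0, hP⟩ (mono ?_ hP))⟩
    all_goals
      rintro ⟨x, y⟩ ⟨hp, hq⟩
      simp only [A4, A1, A3, Cneg, Cpos, Set.mem_sdiff, mem_ofPred_eq] at hp hq ⊢
      have := mul_nonneg hv0 (le_exp hp.1)
      grind

end
end

section
/- The sets L*(Π) and U*(Π) are closed, order-convex subsets of ℝ (hence intervals): if u₁, u₂ ∈ L*(Π) and u₁ ≤ u ≤ u₂ then u ∈ L*(Π); if uₙ ∈ L*(Π) for all n and uₙ → u in ℝ, then u ∈ L*(Π); and the same two statements hold with U*(Π) in place of L*(Π). (This is the key structural fact behind the paper's assertion that the sets of values on which the GOU process is almost surely increasing, respectively decreasing, are connected.) -/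
open MeasureTheory Set Filter

noncomputable section

lemma Cneg_subset_union {u₁ u₂ u : ℝ} (h₁ : u₁ ≤ u) (h₂ : u ≤ u₂) :
    Cneg u ⊆ Cneg u₁ ∪ Cneg u₂ := by
  intro p hp
  simp only [Cneg, mem_union, mem_ofPred_eq] at hp ⊢
  rcases le_total 0 (Real.exp (-p.1) - 1) with h | h
  · exact Or.inr (by linarith [mul_le_mul_of_nonneg_right h₂ h])
  · exact Or.inl (by linarith [mul_le_mul_of_nonpos_right h₁ h])

lemma Cpos_subset_union_s10 {u₁ u₂ u : ℝ} (h₁ : u₁ ≤ u) (h₂ : u ≤ u₂) :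
    Cpos u ⊆ Cpos u₁ ∪ Cpos u₂ := by
  intro p hp
  simp only [Cpos, mem_union, mem_ofPred_eq] at hp ⊢
  rcases le_total 0 (Real.exp (-p.1) - 1) with h | h
  · exact Or.inl (by linarith [mul_le_mul_of_nonneg_right h₁ h])
  · exact Or.inr (by linarith [mul_le_mul_of_nonpos_right h₂ h])

lemma Cneg_subset_iUnion {v : ℕ → ℝ} {u : ℝ} (hv : Tendsto v atTop (nhds u)) :
    Cneg u ⊆ ⋃ n, Cneg (v n) := by
  intro p hp
  have h := (hv.mul_const (Real.exp (-p.1) - 1)).const_sub p.2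
  exact mem_iUnion.2 (h.eventually_lt_const hp).exists

lemma Cpos_subset_iUnion {v : ℕ → ℝ} {u : ℝ} (hv : Tendsto v atTop (nhds u)) :
    Cpos u ⊆ ⋃ n, Cpos (v n) := by
  intro p hp
  have h := (hv.mul_const (Real.exp (-p.1) - 1)).const_sub p.2
  exact mem_iUnion.2 (h.eventually_const_lt hp).exists

theorem lstar_ustar_ordConnected_closed (mu : Measure (ℝ × ℝ)) :
    (∀ u₁ u₂ u : ℝ, u₁ ∈ Lstar mu → u₂ ∈ Lstar mu → u₁ ≤ u → u ≤ u₂ → u ∈ Lstar mu) ∧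
    (∀ (v : ℕ → ℝ) (u : ℝ), (∀ n, v n ∈ Lstar mu) →
      Filter.Tendsto v Filter.atTop (nhds u) → u ∈ Lstar mu) ∧
    (∀ u₁ u₂ u : ℝ, u₁ ∈ Ustar mu → u₂ ∈ Ustar mu → u₁ ≤ u → u ≤ u₂ → u ∈ Ustar mu) ∧
    (∀ (v : ℕ → ℝ) (u : ℝ), (∀ n, v n ∈ Ustar mu) →
      Filter.Tendsto v Filter.atTop (nhds u) → u ∈ Ustar mu) := by
  exact ⟨fun _ _ _ h₁ h₂ hl hr =>
      measure_mono_null (Cneg_subset_union hl hr) (measure_union_null h₁ h₂),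
    fun _ _ h hv => measure_mono_null (Cneg_subset_iUnion hv) (measure_iUnion_null h),
    fun _ _ _ h₁ h₂ hl hr =>
      measure_mono_null (Cpos_subset_union_s10 hl hr) (measure_union_null h₁ h₂),
    fun _ _ h hv => measure_mono_null (Cpos_subset_iUnion hv) (measure_iUnion_null h)⟩

end
end

section
/- Suppose L*(Π) ≠ ∅ and b := sup L*(Π) < ∞. Then b ∈ L*(Π), and for every v > b one has Π({(x,y) ∈ ℝ² : exp(x)·(v + y) ≤ b}) = 0. (Measure-theoretic form of statement (1) of Proposition 'endpoints of L star': exp(x)·(v+y) is the position of the GOU process immediately after a jump (x,y) of the driving Lévy process occurring from position v, so a path of the GOU process that is strictly above sup L* cannot jump to or below sup L*; L* acts as a barrier for negative jumps.) -/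
open MeasureTheory Set Filter

noncomputable section

theorem isClosed_Lstar (mu : Measure (ℝ × ℝ)) : IsClosed (Lstar mu) := by
  refine IsSeqClosed.isClosed fun u b hu hlim ↦ ?_
  have hcover : Cneg b ⊆ ⋃ n, Cneg (u n) := by
    intro p hp
    have htend : Tendsto (fun n ↦ p.2 - u n * (Real.exp (-p.1) - 1)) atTop
        (nhds (p.2 - b * (Real.exp (-p.1) - 1))) :=
      (hlim.mul_const _).const_sub _
    obtain ⟨n, hn⟩ := (htend.eventually_lt_const hp).exists
    exact mem_iUnion.2 ⟨n, hn⟩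
  exact measure_mono_null hcover (measure_iUnion_null hu)

/-- A jump from strictly above `b` to or below `b` lies in the negative-jump region of `b`. -/
theorem setOf_exp_mul_add_le_subset_Cneg {b v : ℝ} (hv : b < v) :
    {p : ℝ × ℝ | Real.exp p.1 * (v + p.2) ≤ b} ⊆ Cneg b := by
  intro p hp
  have hle : v + p.2 ≤ b * Real.exp (-p.1) := by
    rw [Real.exp_neg, ← div_eq_mul_inv, le_div_iff₀' (Real.exp_pos _)]
    exact hp
  change p.2 - b * (Real.exp (-p.1) - 1) < 0
  linarith

theorem lstar_sup_mem_and_barrier (mu : Measure (ℝ × ℝ))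
    (hne : (Lstar mu).Nonempty) (hbdd : BddAbove (Lstar mu)) :
    sSup (Lstar mu) ∈ Lstar mu ∧
      ∀ v : ℝ, sSup (Lstar mu) < v →
        mu {p : ℝ × ℝ | Real.exp p.1 * (v + p.2) ≤ sSup (Lstar mu)} = 0 := by
  have hmem := (isClosed_Lstar mu).csSup_mem hne hbdd
  exact ⟨hmem, fun v hv ↦ measure_mono_null (setOf_exp_mul_add_le_subset_Cneg hv) hmem⟩

end
end

section
/- Assume Π({(0,0)}) = 0. Then: (i) for every c ∈ ℝ, c ∈ L*(Π) ∩ U*(Π) if and only if Π({(x,y) ∈ ℝ² : y ≠ c·(exp(−x) − 1)}) = 0, i.e. Π is carried by the curve {(x,y) : y = c(e^{−x}−1)}; (ii) if Π ≠ 0 then L*(Π) ∩ U*(Π) contains at most one element. (Jump-measure content of the equivalence proposition for the degenerate case of the GOU process: if c₁ ≠ c₂ both lay in L* ∩ U*, the measure would be carried by two curves meeting only at the origin, forcing Π = 0.) -/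
open MeasureTheory Set Filter

noncomputable section

/-- The complement of the curve `y = c (e^{-x} - 1)` is the union of the regions below and above. -/
theorem setOf_ne_eq_Cneg_union_Cpos (c : ℝ) :
    {p : ℝ × ℝ | p.2 ≠ c * (Real.exp (-p.1) - 1)} = Cneg c ∪ Cpos c := by
  ext p
  simp only [Cneg, Cpos, mem_ofPred_eq, mem_union, sub_neg, sub_pos]
  exact ne_iff_lt_or_gt

theorem mem_Lstar_inter_Ustar_iff (mu : Measure (ℝ × ℝ)) (c : ℝ) :
    c ∈ Lstar mu ∩ Ustar mu ↔
      mu {p : ℝ × ℝ | p.2 ≠ c * (Real.exp (-p.1) - 1)} = 0 := by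
  rw [setOf_ne_eq_Cneg_union_Cpos, measure_union_null_iff]
  rfl

/-- Two curves `y = a (e^{-x} - 1)` and `y = b (e^{-x} - 1)` with `a ≠ b` meet only at the
origin. -/
theorem eq_zero_of_mem_curves {a b : ℝ} (hab : a ≠ b) {p : ℝ × ℝ}
    (ha : p.2 = a * (Real.exp (-p.1) - 1)) (hb : p.2 = b * (Real.exp (-p.1) - 1)) :
    p = (0, 0) := by
  have hexp : Real.exp (-p.1) - 1 = 0 :=
    (mul_eq_mul_right_iff.mp (ha.symm.trans hb)).resolve_left hab
  have hx : p.1 = 0 := by simpa [sub_eq_zero] using hexp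
  exact Prod.ext hx (by rw [ha, hexp, mul_zero])

theorem lstar_inter_ustar (mu : Measure (ℝ × ℝ))
    (h0 : mu {((0 : ℝ), (0 : ℝ))} = 0) :
    (∀ c : ℝ, c ∈ Lstar mu ∩ Ustar mu ↔
      mu {p : ℝ × ℝ | p.2 ≠ c * (Real.exp (-p.1) - 1)} = 0) ∧
    (mu ≠ 0 → (Lstar mu ∩ Ustar mu).Subsingleton) := by
  refine ⟨mem_Lstar_inter_Ustar_iff mu, fun hmu a ha b hb => ?_⟩
  by_contra hab
  rw [mem_Lstar_inter_Ustar_iff] at ha hb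
  refine hmu (Measure.measure_univ_eq_zero.mp (measure_mono_null (fun p _ => ?_)
    (measure_union_null (measure_union_null ha hb) h0)))
  by_cases hpa : p.2 = a * (Real.exp (-p.1) - 1)
  · by_cases hpb : p.2 = b * (Real.exp (-p.1) - 1)
    · exact Or.inr (eq_zero_of_mem_curves hab hpa hpb)
    · exact Or.inl (Or.inr hpb)
  · exact Or.inl (Or.inl hpa)

end
end

section
/- (i) L*(Π) = ℝ if and only if Π({(x,y) ∈ ℝ² : x ≠ 0 or y < 0}) = 0, i.e. Π is carried by the half-axis {0} × [0,∞); (ii) U*(Π) = ℝ if and only if Π({(x,y) ∈ ℝ² : x ≠ 0 or y > 0}) = 0; (iii) L*(Π) = U*(Π) = ℝ if and only if Π({(x,y) ∈ ℝ² : (x,y) ≠ (0,0)}) = 0. (Jump-measure content of the proposition that L = ℝ iff ξ ≡ 0 and η is a subordinator, U = ℝ iff ξ ≡ 0 and −η is a subordinator, and L = U = ℝ iff ξ ≡ η ≡ 0.) -/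
open MeasureTheory Set Filter

noncomputable section

theorem exists_int_mul_gt {c : ℝ} (hc : c ≠ 0) (y : ℝ) : ∃ n : ℤ, y < n * c := by
  rcases hc.lt_or_gt with hc | hc
  · obtain ⟨n, hn⟩ := exists_int_lt (y / c)
    exact ⟨n, (lt_div_iff_of_neg hc).1 hn⟩
  · obtain ⟨n, hn⟩ := exists_int_gt (y / c)
    exact ⟨n, (div_lt_iff₀ hc).1 hn⟩

theorem exp_neg_sub_one_ne_zero {x : ℝ} (hx : x ≠ 0) : Real.exp (-x) - 1 ≠ 0 := by
  rw [sub_ne_zero, Ne, Real.exp_eq_one_iff]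
  exact neg_ne_zero.2 hx

theorem Cneg_subset (u : ℝ) : Cneg u ⊆ {p : ℝ × ℝ | p.1 ≠ 0 ∨ p.2 < 0} := by
  rintro ⟨x, y⟩ h
  by_cases hx : x = 0
  · exact Or.inr (by simpa [Cneg, hx] using h)
  · exact Or.inl hx

theorem Cpos_subset (u : ℝ) : Cpos u ⊆ {p : ℝ × ℝ | p.1 ≠ 0 ∨ 0 < p.2} := by
  rintro ⟨x, y⟩ h
  by_cases hx : x = 0
  · exact Or.inr (by simpa [Cpos, hx] using h)
  · exact Or.inl hx

theorem iUnion_Cneg : ⋃ n : ℤ, Cneg n = {p : ℝ × ℝ | p.1 ≠ 0 ∨ p.2 < 0} := by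
  refine (iUnion_subset fun n : ℤ => Cneg_subset n).antisymm ?_
  rintro ⟨x, y⟩ (hx | hy)
  · obtain ⟨n, hn⟩ := exists_int_mul_gt (exp_neg_sub_one_ne_zero hx) y
    exact mem_iUnion.2 ⟨n, sub_neg.2 hn⟩
  · exact mem_iUnion.2 ⟨0, by simpa [Cneg] using hy⟩

theorem iUnion_Cpos : ⋃ n : ℤ, Cpos n = {p : ℝ × ℝ | p.1 ≠ 0 ∨ 0 < p.2} := by
  refine (iUnion_subset fun n : ℤ => Cpos_subset n).antisymm ?_
  rintro ⟨x, y⟩ (hx | hy)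
  · obtain ⟨n, hn⟩ := exists_int_mul_gt (neg_ne_zero.2 (exp_neg_sub_one_ne_zero hx)) (-y)
    refine mem_iUnion.2 ⟨n, ?_⟩
    change 0 < y - n * (Real.exp (-x) - 1)
    linarith
  · exact mem_iUnion.2 ⟨0, by simpa [Cpos] using hy⟩

theorem Lstar_eq_univ_iff (mu : Measure (ℝ × ℝ)) :
    Lstar mu = univ ↔ mu {p : ℝ × ℝ | p.1 ≠ 0 ∨ p.2 < 0} = 0 := by
  rw [eq_univ_iff_forall]
  refine ⟨fun h => ?_, fun h u => measure_mono_null (Cneg_subset u) h⟩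
  rw [← iUnion_Cneg]
  exact measure_iUnion_null fun n => h n

theorem Ustar_eq_univ_iff (mu : Measure (ℝ × ℝ)) :
    Ustar mu = univ ↔ mu {p : ℝ × ℝ | p.1 ≠ 0 ∨ 0 < p.2} = 0 := by
  rw [eq_univ_iff_forall]
  refine ⟨fun h => ?_, fun h u => measure_mono_null (Cpos_subset u) h⟩
  rw [← iUnion_Cpos]
  exact measure_iUnion_null fun n => h n

theorem lstar_ustar_univ_iff (mu : Measure (ℝ × ℝ)) :
    (Lstar mu = Set.univ ↔ mu {p : ℝ × ℝ | p.1 ≠ 0 ∨ p.2 < 0} = 0) ∧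
    (Ustar mu = Set.univ ↔ mu {p : ℝ × ℝ | p.1 ≠ 0 ∨ 0 < p.2} = 0) ∧
    ((Lstar mu = Set.univ ∧ Ustar mu = Set.univ) ↔
      mu {p : ℝ × ℝ | p ≠ ((0 : ℝ), (0 : ℝ))} = 0) := by
  refine ⟨Lstar_eq_univ_iff mu, Ustar_eq_univ_iff mu, ?_⟩
  rw [Lstar_eq_univ_iff, Ustar_eq_univ_iff, ← measure_union_null_iff]
  have h : {p : ℝ × ℝ | p.1 ≠ 0 ∨ p.2 < 0} ∪ {p : ℝ × ℝ | p.1 ≠ 0 ∨ 0 < p.2} =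
      {p : ℝ × ℝ | p ≠ ((0 : ℝ), (0 : ℝ))} := by
    ext ⟨x, y⟩
    simp only [mem_union, mem_ofPred_eq, Ne, Prod.mk.injEq]
    grind
  rw [h]

end
end
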